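/- Let C be a union of a d-complete collection of d-cubes in {0,1}^n, and suppose all iterated reductions C^S over (d−1)-subsets S of directions are trees. Then the number F of distinct (d−1)-dimensional subcubes contained in C satisfies F = binomial(n, d−1) + d·binomial(n, d). -/

import Mathlib

open Finset

/-- A concept class `C` shatters a coordinate set `I` if every assignment of
values to the coordinates in `I` is realized by some concept in `C`. -/
def Shatters {α : Type*} (C : Finset (α → Bool)) (I : Finset α) : Prop :=
  ∀ f : α → Bool, ∃ c ∈ C, ∀ i ∈ I, c i = f i

/-- The VC dimension of a concept class: the largest cardinality of a shattered
coordinate set. -/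
noncomputable def vcDim {α : Type*} [Fintype α] [DecidableEq α]
    (C : Finset (α → Bool)) : ℕ :=
  letI := Classical.decPred (Shatters C)
  (Finset.univ.filter (Shatters C)).sup Finset.card

/-- The subcube with free coordinate set `S` and anchor `a`: all vectors that
agree with `a` outside `S`.  Its dimension is `S.card`. -/
def subcube {α : Type*} [Fintype α] [DecidableEq α] (S : Finset α) (a : α → Bool) :
    Finset (α → Bool) :=
  Finset.univ.filter fun c => ∀ i ∉ S, c i = a i

/-- The iterated reduction of a `d`-complete collection along a `(d-1)`-set `S`
of directions: the graph on the projected cube `{0,1}^{[n]\S}` whose edges are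
the projections of the `d`-cubes of the collection whose direction set contains
`S`.  `f T` is the anchor of the cube of the collection with direction set `T`. -/
noncomputable def iteratedReduction (n : ℕ) (f : Finset (Fin n) → (Fin n → Bool))
    (S : Finset (Fin n)) : SimpleGraph ({i : Fin n // i ∉ S} → Bool) :=
  SimpleGraph.fromRel (fun u v =>
    ∃ x, x ∉ S ∧
      (∃ c ∈ subcube (insert x S) (f (insert x S)),
        ∀ i : {i : Fin n // i ∉ S}, c i.1 = u i) ∧
      (∃ c ∈ subcube (insert x S) (f (insert x S)),
        ∀ i : {i : Fin n // i ∉ S}, c i.1 = v i))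

/-- `u` is a vertex of the iterated reduction along `S`: it is the projection of
a `(d-1)`-face (equivalently, of a point) of a cube of the collection whose
direction set contains `S`. -/
def isReductionVertex (n : ℕ) (f : Finset (Fin n) → (Fin n → Bool))
    (S : Finset (Fin n)) (u : {i : Fin n // i ∉ S} → Bool) : Prop :=
  ∃ x, x ∉ S ∧ ∃ c ∈ subcube (insert x S) (f (insert x S)),
    ∀ i : {i : Fin n // i ∉ S}, c i.1 = u i

lemma mem_subcube_iff' {n : ℕ} (S : Finset (Fin n)) (a c : Fin n → Bool) :
    c ∈ subcube S a ↔ ∀ i ∉ S, c i = a i := by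
  simp [subcube]

lemma forbidden_label (n k : ℕ) (f : Finset (Fin n) → (Fin n → Bool))
    (htrees : ∀ S : Finset (Fin n), S.card = k →
      ∀ u v : {i : Fin n // i ∉ S} → Bool,
        isReductionVertex n f S u → isReductionVertex n f S v →
          (iteratedReduction n f S).Reachable u v)
    (U : Finset (Fin n)) (hU : U.card = k + 2) (m : ℕ) :
    ∀ T : Finset (Fin n), T.card = k + 1 → (T \ U).card = m →
      ∃ u ∈ U, u ∉ T ∧ f T u = f (U.erase u) u := by
  induction m with
  | zero =>
    intro T hT hTU
    have hsub : T ⊆ U := by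
      rw [Finset.card_eq_zero, Finset.sdiff_eq_empty_iff_subset] at hTU
      exact hTU
    obtain ⟨u, hu, huT⟩ := Finset.exists_mem_notMem_of_card_lt_card (s := T) (t := U) (by omega)
    refine ⟨u, hu, huT, ?_⟩
    have : T = U.erase u := by
      apply Finset.eq_of_subset_of_card_le
      · intro x hx
        rw [Finset.mem_erase]
        exact ⟨fun h => huT (h ▸ hx), hsub hx⟩
      · rw [Finset.card_erase_of_mem hu]; omega
    rw [← this]
  | succ m ih =>
    intro T hT hTU
    by_contra hcon
    push Not at hcon
    obtain ⟨z, hz⟩ : (T \ U).Nonempty := by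
      rw [← Finset.card_pos]; omega
    rw [Finset.mem_sdiff] at hz
    obtain ⟨hzT, hzU⟩ := hz
    obtain ⟨u0, hu0, hu0T⟩ := Finset.exists_mem_notMem_of_card_lt_card (s := T) (t := U) (by omega)
    set S := T.erase z with hS
    have hScard : S.card = k := by rw [hS, Finset.card_erase_of_mem hzT]; omega
    have hzS : z ∉ S := by simp [hS]
    have hins : insert z S = T := Finset.insert_erase hzT
    have hnS : ∀ u, u ∉ T → u ∉ S := fun u hu h => hu (Finset.mem_of_mem_erase h)
    have hr := htrees S hScard (fun i => f T i.1)
      (fun i => Function.update (f (insert u0 S)) u0 (!(f T u0)) i.1)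
      ⟨z, hzS, f T, by rw [hins, mem_subcube_iff']; intros; rfl, fun _ => rfl⟩
      ⟨u0, hnS _ hu0T, Function.update (f (insert u0 S)) u0 (!(f T u0)), by
        rw [mem_subcube_iff']
        intro i hi
        rw [Function.update_of_ne]
        rintro rfl
        exact hi (Finset.mem_insert_self _ _), fun _ => rfl⟩
    obtain ⟨w⟩ := hr
    obtain ⟨dd, -, h1, h2⟩ := w.exists_boundary_dart
      {v | ∀ i : {i : Fin n // i ∉ S}, i.1 ∈ U → i.1 ∉ T → v i = f T i.1}
      (by intro i _ _; rfl)
      (by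
        intro h
        have := h ⟨u0, hnS _ hu0T⟩ hu0 hu0T
        simp at this)
    have hadj := dd.adj
    simp only [Set.mem_setOf_eq] at h1 h2
    generalize dd.fst = a at *
    generalize dd.snd = b at *
    push Not at h2
    obtain ⟨⟨u, huS⟩, huU, huT, hub⟩ := h2
    simp only at huU huT hub
    have key : ∃ x, x ∉ S ∧ (∀ i : {i : Fin n // i ∉ S}, i.1 ≠ x →
        a i = f (insert x S) i.1 ∧ b i = f (insert x S) i.1) := by
      rw [iteratedReduction, SimpleGraph.fromRel_adj] at hadj
      obtain ⟨-, h | h⟩ := hadj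
      · obtain ⟨x, hx, ⟨c, hc, hca⟩, ⟨c', hc', hcb⟩⟩ := h
        rw [mem_subcube_iff'] at hc hc'
        refine ⟨x, hx, fun i hi => ⟨?_, ?_⟩⟩
        · rw [← hca, hc]; simp [hi, i.2]
        · rw [← hcb, hc']; simp [hi, i.2]
      · obtain ⟨x, hx, ⟨c, hc, hca⟩, ⟨c', hc', hcb⟩⟩ := h
        rw [mem_subcube_iff'] at hc hc'
        refine ⟨x, hx, fun i hi => ⟨?_, ?_⟩⟩
        · rw [← hcb, hc']; simp [hi, i.2]
        · rw [← hca, hc]; simp [hi, i.2]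
    obtain ⟨x, hx, hab⟩ := key
    have hxu : u = x := by
      by_contra hne
      have h3 := hab ⟨u, huS⟩ hne
      have h4 := h1 ⟨u, huS⟩ huU huT
      exact hub (by rw [h3.2, ← h3.1, h4])
    subst hxu
    have hsd : insert u S \ U = (T \ U).erase z := by
      ext y
      simp only [hS, Finset.mem_sdiff, Finset.mem_insert, Finset.mem_erase]
      constructor
      · rintro ⟨rfl | h, h'⟩
        · exact absurd huU h'
        · exact ⟨h.1, h.2, h'⟩
      · rintro ⟨h, h', h''⟩
        exact ⟨Or.inr ⟨h, h'⟩, h''⟩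
    obtain ⟨v, hvU, hvT', hv⟩ := ih (insert u S)
      (by rw [Finset.card_insert_of_notMem hx]; omega)
      (by
        rw [hsd, Finset.card_erase_of_mem (Finset.mem_sdiff.2 ⟨hzT, hzU⟩)]; omega)
    rw [Finset.mem_insert, not_or] at hvT'
    have hvz : v ≠ z := by rintro rfl; exact hzU hvU
    have hvT : v ∉ T := fun h => hvT'.2 (Finset.mem_erase.2 ⟨hvz, h⟩)
    have h3 := hab ⟨v, hvT'.2⟩ hvT'.1
    have h4 := h1 ⟨v, hvT'.2⟩ hvU hvT
    exact hcon v hvU hvT (by rw [← hv, ← h3.1, h4])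

/-- A set of Boolean vectors with an edge in each direction of `J` has at least `|J|+1` points. -/
lemma card_ge_of_edges {n : ℕ} (V : Finset (Fin n → Bool)) (hV : V.Nonempty)
    (J : Finset (Fin n))
    (h : ∀ x ∈ J, ∃ a ∈ V, ∃ b ∈ V, a x ≠ b x ∧ ∀ i ∈ J, i ≠ x → a i = b i) :
    J.card + 1 ≤ V.card := by
  have main : ∀ K : Finset (Fin n), K ⊆ J →
      K.card + 1 ≤ (V.image (fun v i => decide (i ∈ K) && v i)).card := by
    intro K
    induction K using Finset.induction_on with
    | empty =>
      intro _
      have := (hV.image (fun v i => decide (i ∈ (∅ : Finset (Fin n))) && v i)).card_pos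
      simpa using this
    | insert x K hx ih =>
      intro hK
      have ih' := ih (fun i hi => hK (Finset.mem_insert_of_mem hi))
      rw [Finset.card_insert_of_notMem hx]
      obtain ⟨a, ha, b, hb, hne, hab⟩ := h x (hK (Finset.mem_insert_self _ _))
      have himg : V.image (fun v i => decide (i ∈ K) && v i) =
          (V.image (fun v i => decide (i ∈ insert x K) && v i)).image
            (fun v i => decide (i ∈ K) && v i) := by
        rw [Finset.image_image]
        congr 1
        funext v i
        by_cases hi : i ∈ K <;> simp [hi]
      have hlt : ((V.image (fun v i => decide (i ∈ insert x K) && v i)).image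
            (fun v i => decide (i ∈ K) && v i)).card <
          (V.image (fun v i => decide (i ∈ insert x K) && v i)).card := by
        refine lt_of_le_of_ne Finset.card_image_le ?_
        intro heq
        have hinj := Finset.card_image_iff.1 heq
        have := hinj (Finset.mem_coe.2 (Finset.mem_image_of_mem _ ha))
          (Finset.mem_coe.2 (Finset.mem_image_of_mem _ hb)) (by
            funext i
            by_cases hi : i ∈ K
            · have hix : i ≠ x := by rintro rfl; exact hx hi
              simp [hi, hab i (hK (Finset.mem_insert_of_mem hi)) hix]
            · simp [hi])
        have := congrFun this x
        simp at this
        exact hne this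
      rw [← himg] at hlt
      omega
  exact (main J (Finset.Subset.refl _)).trans Finset.card_image_le

lemma card_fiber (n k : ℕ) (hk : k + 1 ≤ n) (f : Finset (Fin n) → (Fin n → Bool))
    (C : Finset (Fin n → Bool))
    (hC : C = (Finset.univ.filter (fun S : Finset (Fin n) => S.card = k + 1)).biUnion
      (fun S => subcube S (f S)))
    (htrees : ∀ S : Finset (Fin n), S.card = k →
      ∀ u v : {i : Fin n // i ∉ S} → Bool,
        isReductionVertex n f S u → isReductionVertex n f S v →
          (iteratedReduction n f S).Reachable u v)
    (S : Finset (Fin n)) (hS : S.card = k) :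
    ((Finset.univ : Finset (Fin n → Bool)).filter
      (fun a => (∀ i ∈ S, a i = false) ∧ subcube S a ⊆ C)).card = n - k + 1 := by
  have hSc : (Sᶜ).card = n - k := by rw [Finset.card_compl, hS, Fintype.card_fin]
  set V := (Finset.univ : Finset (Fin n → Bool)).filter
      (fun a => (∀ i ∈ S, a i = false) ∧ subcube S a ⊆ C) with hVdef
  have hface : ∀ x ∉ S, ∀ e : Bool,
      (fun i => if i ∈ S then false else if i = x then e else f (insert x S) i) ∈ V := by
    intro x hx e
    rw [hVdef, Finset.mem_filter]
    refine ⟨Finset.mem_univ _, fun i hi => by simp [hi], ?_⟩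
    intro c hc
    rw [mem_subcube_iff'] at hc
    rw [hC, Finset.mem_biUnion]
    refine ⟨insert x S, by simp [Finset.card_insert_of_notMem hx, hS], ?_⟩
    rw [mem_subcube_iff']
    intro i hi
    rw [Finset.mem_insert, not_or] at hi
    rw [hc i hi.2]
    simp [hi.1, hi.2]
  apply le_antisymm
  · -- upper bound by Sauer-Shelah
    let supp : (Fin n → Bool) → Finset (Fin n) := fun a => Finset.univ.filter (fun i => a i = true)
    have hsupp : Function.Injective supp := by
      intro a b hab
      funext i
      have : i ∈ supp a ↔ i ∈ supp b := by rw [hab]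
      simp only [supp, Finset.mem_filter, Finset.mem_univ, true_and] at this
      exact Bool.eq_iff_iff.2 this
    have hcard : (V.image supp).card = V.card := Finset.card_image_of_injective _ hsupp
    rw [← hcard]
    refine (Finset.card_le_card_shatterer _).trans ?_
    have hsub : (V.image supp).shatterer ⊆ insert ∅ ((Sᶜ).image (fun x => ({x} : Finset (Fin n)))) := by
      intro s hs
      rw [Finset.mem_shatterer] at hs
      have hreal : ∀ t ⊆ s, ∃ a ∈ V, ∀ i ∈ s, (a i = true ↔ i ∈ t) := by
        intro t ht
        obtain ⟨u, hu, hst⟩ := hs ht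
        obtain ⟨a, ha, rfl⟩ := Finset.mem_image.1 hu
        refine ⟨a, ha, fun i hi => ?_⟩
        rw [← hst]
        simp [supp, hi]
      have hsS : ∀ x ∈ s, x ∉ S := by
        intro x hx hxS
        obtain ⟨a, ha, hat⟩ := hreal s (Finset.Subset.refl _)
        have h1 := (hat x hx).2 hx
        rw [hVdef, Finset.mem_filter] at ha
        rw [ha.2.1 x hxS] at h1
        exact absurd h1 (by simp)
      have hone : s.card ≤ 1 := by
        by_contra hgt
        obtain ⟨x, hx, y, hy, hxy⟩ := Finset.one_lt_card.1 (not_le.1 hgt)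
        set U := insert x (insert y S) with hUdef
        have hUc : U.card = k + 2 := by
          rw [hUdef, Finset.card_insert_of_notMem, Finset.card_insert_of_notMem (hsS y hy), hS]
          simp [hxy, hsS x hx]
        -- forbidden label
        obtain ⟨a, ha, hat⟩ := hreal (s.filter (fun i => f (U.erase i) i = false))
          (Finset.filter_subset _ _)
        have hav : ∀ i ∈ s, a i = !(f (U.erase i) i) := by
          intro i hi
          have := hat i hi
          simp only [Finset.mem_filter, hi, true_and] at this
          rw [Bool.eq_iff_iff, this]
          simp
        rw [hVdef, Finset.mem_filter] at ha
        have hcC : (fun i => if i ∈ S then !(f (U.erase i) i) else a i) ∈ C := by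
          apply ha.2.2
          rw [mem_subcube_iff']
          intro i hi
          simp [hi]
        rw [hC, Finset.mem_biUnion] at hcC
        obtain ⟨T, hT, hcT⟩ := hcC
        rw [Finset.mem_filter] at hT
        rw [mem_subcube_iff'] at hcT
        obtain ⟨u, huU, huT, hu⟩ := forbidden_label n k f htrees U hUc _ T hT.2 rfl
        have h1 := hcT u huT
        rw [hu] at h1
        by_cases huS : u ∈ S
        · simp [huS] at h1
        · have hus : u ∈ s := by
            rw [hUdef, Finset.mem_insert, Finset.mem_insert] at huU
            rcases huU with rfl | rfl | h
            · exact hx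
            · exact hy
            · exact absurd h huS
          simp [huS, hav u hus] at h1
      rw [Finset.mem_insert, Finset.mem_image]
      rcases Nat.le_one_iff_eq_zero_or_eq_one.1 hone with h0 | h1
      · left; exact Finset.card_eq_zero.1 h0
      · right
        obtain ⟨x, rfl⟩ := Finset.card_eq_one.1 h1
        exact ⟨x, Finset.mem_compl.2 (hsS x (Finset.mem_singleton_self x)), rfl⟩
    refine (Finset.card_le_card hsub).trans ((Finset.card_insert_le _ _).trans ?_)
    have := Finset.card_image_le (s := Sᶜ) (f := fun x => ({x} : Finset (Fin n)))
    omega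
  · rw [← hSc]
    have hne : (Sᶜ).Nonempty := by rw [← Finset.card_pos]; omega
    apply card_ge_of_edges
    · obtain ⟨x, hx⟩ := hne
      exact ⟨_, hface x (Finset.mem_compl.1 hx) true⟩
    · intro x hx
      rw [Finset.mem_compl] at hx
      refine ⟨_, hface x hx true, _, hface x hx false, by simp [hx], ?_⟩
      intro i _ hix
      simp [hix]

/-- If `C` is the union of a `d`-complete collection and all `(d-1)`-iterated
reductions are trees (connected), then the number `F` of distinct
`(d-1)`-dimensional subcubes contained in `C` (counted as pairs of a free
direction set and a normalized anchor) equals `C(n,d-1) + d·C(n,d)`. -/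
theorem count_faces_of_trees (n d : ℕ) (hd : 1 ≤ d) (hdn : d ≤ n)
    (f : Finset (Fin n) → (Fin n → Bool))
    (C : Finset (Fin n → Bool))
    (hC : C = (Finset.univ.filter (fun S : Finset (Fin n) => S.card = d)).biUnion
      (fun S => subcube S (f S)))
    (htrees : ∀ S : Finset (Fin n), S.card = d - 1 →
      ∀ u v : {i : Fin n // i ∉ S} → Bool,
        isReductionVertex n f S u → isReductionVertex n f S v →
          (iteratedReduction n f S).Reachable u v) :
    (((Finset.univ : Finset (Finset (Fin n) × (Fin n → Bool))).filter
        (fun p => p.1.card = d - 1 ∧ (∀ i ∈ p.1, p.2 i = false) ∧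
          subcube p.1 p.2 ⊆ C)).card)
      = n.choose (d - 1) + d * n.choose d := by
  obtain ⟨k, rfl⟩ : ∃ k, d = k + 1 := ⟨d - 1, by omega⟩
  simp only [Nat.add_sub_cancel] at htrees ⊢
  have hfib := card_fiber n k hdn f C hC htrees
  rw [Finset.card_eq_sum_card_fiberwise (f := Prod.fst)
    (t := Finset.powersetCard k (Finset.univ : Finset (Fin n)))]
  · rw [Finset.sum_congr rfl (g := fun _ => n - k + 1)]
    · rw [Finset.sum_const, Finset.card_powersetCard, Finset.card_univ, Fintype.card_fin,
        smul_eq_mul]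
      have := Nat.choose_succ_right_eq n k
      rw [mul_add, ← this]
      ring
    · intro S hS
      have hSk : S.card = k := (Finset.mem_powersetCard.1 hS).2
      rw [← hfib S hSk]
      symm
      apply Finset.card_bij (fun a _ => (S, a))
      · intro a ha
        simpa [hSk] using ha
      · intro a _ b _ hab
        exact (Prod.mk.inj hab).2
      · rintro ⟨S', a⟩ h
        simp only [Finset.mem_filter, Finset.mem_univ, true_and] at h
        obtain ⟨⟨_, h2, h3⟩, rfl⟩ := h
        exact ⟨a, by simpa using ⟨h2, h3⟩, rfl⟩
  · intro p hp
    simp only [Finset.coe_filter, Finset.mem_univ, true_and, Set.mem_setOf_eq] at hp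
    simp [hp.1]
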